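/- Let q ≥ 1 and n ≥ 2 be integers and let X be a connected (q+1)-regular simple undirected graph on n vertices. For every odd integer k ≥ 1, trace(W^k) = q^{k/2} · trace(T_k(q^{−1/2} A)), where T_k(q^{−1/2}A) denotes the evaluation of the polynomial T_k at the matrix q^{−1/2}A. -/

import Mathlib

open Matrix Filter

noncomputable section

/-- The non-backtracking (Hashimoto) matrix of a graph, indexed by darts:
`W e f = 1` if the end of `e` is the start of `f` and `f` is not the reversal of `e`. -/
def hashimoto {n : ℕ} (X : SimpleGraph (Fin n)) [DecidableRel X.Adj] :
    Matrix X.Dart X.Dart ℝ :=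
  Matrix.of fun e f => if e.toProd.2 = f.toProd.1 ∧ f ≠ e.symm then 1 else 0

/-- `N_k = trace(W^k)`, the number of geodesic cycles of length `k`. -/
def Ngc {n : ℕ} (X : SimpleGraph (Fin n)) [DecidableRel X.Adj] (k : ℕ) : ℝ :=
  (hashimoto X ^ k).trace

/-- The sequence `H_k`. -/
def Hseq (q : ℕ) {n : ℕ} (X : SimpleGraph (Fin n)) [DecidableRel X.Adj] (k : ℕ) : ℝ :=
  if Odd k then
    2 * ((n : ℝ) - 1) + Real.sqrt q ^ k + (Real.sqrt q ^ k)⁻¹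
      - (Real.sqrt q ^ k)⁻¹ * Ngc X k
  else
    2 * ((n : ℝ) - 1) + Real.sqrt q ^ k + (Real.sqrt q ^ k)⁻¹
      - (Real.sqrt q ^ k)⁻¹ * (Ngc X k - (n : ℝ) * ((q : ℝ) - 1))

/-- `μ(X) = q^{-1/2} · max_{2 ≤ i ≤ n} |λ_i|`, where `lam` enumerates the eigenvalues
in decreasing order (indices starting from `0`). -/
def mu (q : ℕ) {n : ℕ} (lam : Fin n → ℝ) : ℝ :=
  (Real.sqrt q)⁻¹ * sSup {x : ℝ | ∃ i : Fin n, (i : ℕ) ≠ 0 ∧ x = |lam i|}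

/-- The polynomials `T_k` as elements of `ℝ[X]`:
`T_0 = 2`, `T_1 = X`, `T_{k+1} = X·T_k − T_{k−1}`. -/
def Tpoly : ℕ → Polynomial ℝ
  | 0 => 2
  | 1 => Polynomial.X
  | (k + 2) => Polynomial.X * Tpoly (k + 1) - Tpoly k

section Incidence

variable {V : Type*} [Fintype V] [DecidableEq V] (X : SimpleGraph V) [DecidableRel X.Adj]

/-- The matrix recording the initial vertex of each dart. -/
def dartSource : Matrix X.Dart V ℝ := Matrix.of fun e v => if e.fst = v then 1 else 0

/-- The matrix recording the terminal vertex of each dart. -/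
def dartTarget : Matrix X.Dart V ℝ := Matrix.of fun e v => if e.snd = v then 1 else 0

/-- The permutation matrix of dart reversal. -/
def dartReversal : Matrix X.Dart X.Dart ℝ := Matrix.of fun e f => if e.symm = f then 1 else 0

lemma dartReversal_mul_apply {ι : Type*} (M : Matrix X.Dart ι ℝ) (e : X.Dart) (i : ι) :
    (dartReversal X * M) e i = M e.symm i := by
  simp [dartReversal, Matrix.mul_apply]

lemma dartReversal_mul_dartSource : dartReversal X * dartSource X = dartTarget X := by
  ext e v
  rw [dartReversal_mul_apply]
  simp [dartSource, dartTarget]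

lemma dartReversal_mul_dartTarget : dartReversal X * dartTarget X = dartSource X := by
  ext e v
  rw [dartReversal_mul_apply]
  simp [dartSource, dartTarget]

lemma dartReversal_mul_self : dartReversal X * dartReversal X = 1 := by
  ext e f
  rw [dartReversal_mul_apply]
  simp [dartReversal, Matrix.one_apply]

lemma transpose_dartReversal : (dartReversal X)ᵀ = dartReversal X := by
  ext e f
  simp only [dartReversal, Matrix.transpose_apply, Matrix.of_apply]
  congr 1
  exact propext (SimpleGraph.Dart.symm_involutive.eq_iff.trans eq_comm)

lemma trace_dartReversal : (dartReversal X).trace = 0 := by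
  simp [dartReversal, Matrix.trace, SimpleGraph.Dart.symm_ne]

lemma transpose_dartSource_mul_dartReversal :
    (dartSource X)ᵀ * dartReversal X = (dartTarget X)ᵀ := by
  rw [← dartReversal_mul_dartSource, Matrix.transpose_mul, transpose_dartReversal]

lemma transpose_dartSource_mul_dartTarget :
    (dartSource X)ᵀ * dartTarget X = X.adjMatrix ℝ := by
  ext u v
  simp only [dartSource, dartTarget, Matrix.mul_apply, Matrix.transpose_apply, Matrix.of_apply,
    SimpleGraph.adjMatrix_apply, ← ite_and, mul_ite, mul_one, mul_zero]
  split_ifs with h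
  · rw [Finset.sum_eq_single (⟨(u, v), h⟩ : X.Dart)]
    · simp
    · rintro e - he
      refine if_neg fun h' => he ?_
      ext1
      exact Prod.ext h'.2 h'.1
    · simp
  · refine Finset.sum_eq_zero fun e _ => if_neg fun h' => h ?_
    rw [← h'.1, ← h'.2]
    exact e.adj

lemma transpose_dartTarget_mul_dartSource :
    (dartTarget X)ᵀ * dartSource X = X.adjMatrix ℝ := by
  rw [← Matrix.transpose_inj, Matrix.transpose_mul, Matrix.transpose_transpose,
    transpose_dartSource_mul_dartTarget, SimpleGraph.transpose_adjMatrix]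

variable {X}

lemma transpose_dartSource_mul_self {d : ℕ} (hreg : X.IsRegularOfDegree d) :
    (dartSource X)ᵀ * dartSource X = (d : ℝ) • 1 := by
  ext u v
  simp only [dartSource, Matrix.mul_apply, Matrix.transpose_apply, Matrix.of_apply,
    Matrix.smul_apply, Matrix.one_apply, ← ite_and, mul_ite, mul_one, mul_zero, smul_eq_mul]
  split_ifs with h
  · subst h
    simp only [and_self, Finset.sum_boole]
    rw [X.dart_fst_fiber_card_eq_degree, hreg.degree_eq]
  · exact Finset.sum_eq_zero fun e _ => if_neg fun h' => h (h'.2.symm.trans h'.1)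

lemma transpose_dartTarget_mul_self {d : ℕ} (hreg : X.IsRegularOfDegree d) :
    (dartTarget X)ᵀ * dartTarget X = (d : ℝ) • 1 := by
  rw [← transpose_dartSource_mul_dartReversal, Matrix.mul_assoc, dartReversal_mul_dartTarget,
    transpose_dartSource_mul_self hreg]

end Incidence

/-- The sequence `U_0 = 0`, `U_1 = 1`, `U_{k+2} = a U_{k+1} - r U_k` in a real algebra. -/
def lucasU {R : Type*} [Ring R] [Algebra ℝ R] (r : ℝ) (a : R) : ℕ → R
  | 0 => 0
  | 1 => 1
  | (k + 2) => a * lucasU r a (k + 1) - r • lucasU r a k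

lemma smul_aeval_Tpoly_succ {R : Type*} [Ring R] [Algebra ℝ R] {s : ℝ} (hs : s ≠ 0) (a : R) :
    ∀ k : ℕ, s ^ (k + 1) • Polynomial.aeval (s⁻¹ • a) (Tpoly (k + 1)) =
      lucasU (s ^ 2) a (k + 2) - s ^ 2 • lucasU (s ^ 2) a k
  | 0 => by simp [Tpoly, lucasU, smul_smul, hs]
  | 1 => by
    simp only [Tpoly, lucasU, map_sub, map_mul, Polynomial.aeval_X, map_ofNat, smul_mul_smul_comm,
      smul_sub, smul_smul, mul_one, smul_zero, sub_zero]
    have h : s ^ (1 + 1) * (s⁻¹ * s⁻¹) = 1 := by field_simp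
    rw [h, ← one_add_one_eq_two, smul_add]
    module
  | (k + 2) => by
    have h₁ := smul_aeval_Tpoly_succ hs a (k + 1)
    have h₀ := smul_aeval_Tpoly_succ hs a k
    have h : s ^ (k + 2 + 1) • Polynomial.aeval (s⁻¹ • a) (Tpoly (k + 2 + 1)) =
        a * (s ^ (k + 1 + 1) • Polynomial.aeval (s⁻¹ • a) (Tpoly (k + 1 + 1))) -
          s ^ 2 • (s ^ (k + 1) • Polynomial.aeval (s⁻¹ • a) (Tpoly (k + 1))) := by
      rw [Tpoly, map_sub, map_mul, Polynomial.aeval_X, smul_sub, smul_mul_assoc, smul_smul,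
        mul_smul_comm, smul_smul]
      congr 2
      · field_simp
        ring
      · ring
    rw [h, h₁, h₀, lucasU.eq_3 _ _ (k + 2), lucasU.eq_3 _ _ k]
    simp only [mul_sub, smul_sub, mul_smul_comm]
    abel

section Hashimoto

variable {n : ℕ} (X : SimpleGraph (Fin n)) [DecidableRel X.Adj]

lemma hashimoto_eq : hashimoto X = dartTarget X * (dartSource X)ᵀ - dartReversal X := by
  ext e f
  have h : e.symm = f → f.fst = e.snd := by rintro rfl; rfl
  simp only [hashimoto, dartTarget, dartSource, dartReversal, Matrix.sub_apply, Matrix.mul_apply,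
    Matrix.transpose_apply, Matrix.of_apply, ite_mul, one_mul, zero_mul, Finset.sum_ite_eq,
    Finset.mem_univ, if_true]
  grind

lemma trace_hashimoto : (hashimoto X).trace = 0 := by
  rw [hashimoto_eq, Matrix.trace_sub, trace_dartReversal, Matrix.trace_mul_comm,
    transpose_dartSource_mul_dartTarget, SimpleGraph.trace_adjMatrix, sub_zero]

lemma hashimoto_mul_dartTarget :
    hashimoto X * dartTarget X = dartTarget X * X.adjMatrix ℝ - dartSource X := by
  rw [hashimoto_eq, Matrix.sub_mul, Matrix.mul_assoc, transpose_dartSource_mul_dartTarget,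
    dartReversal_mul_dartTarget]

lemma hashimoto_pow_add_two (k : ℕ) :
    hashimoto X ^ (k + 2) = hashimoto X ^ k +
      hashimoto X ^ (k + 1) * dartTarget X * (dartSource X)ᵀ -
      hashimoto X ^ k * dartTarget X * (dartTarget X)ᵀ := by
  have h : hashimoto X * dartReversal X = dartTarget X * (dartTarget X)ᵀ - 1 := by
    rw [hashimoto_eq, Matrix.sub_mul, dartReversal_mul_self, Matrix.mul_assoc,
      transpose_dartSource_mul_dartReversal]
  calc hashimoto X ^ (k + 2)
      = hashimoto X ^ (k + 1) * (dartTarget X * (dartSource X)ᵀ - dartReversal X) := by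
        rw [← hashimoto_eq, ← pow_succ]
    _ = hashimoto X ^ (k + 1) * dartTarget X * (dartSource X)ᵀ -
          hashimoto X ^ k * (hashimoto X * dartReversal X) := by
        rw [Matrix.mul_sub, ← Matrix.mul_assoc, ← Matrix.mul_assoc (hashimoto X ^ k), ← pow_succ]
    _ = _ := by
        rw [h, Matrix.mul_sub, Matrix.mul_one, ← Matrix.mul_assoc]
        abel

variable {X} {q : ℕ}

lemma hashimoto_mul_dartSource (hreg : X.IsRegularOfDegree (q + 1)) :
    hashimoto X * dartSource X = (q : ℝ) • dartTarget X := by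
  rw [hashimoto_eq, Matrix.sub_mul, Matrix.mul_assoc, transpose_dartSource_mul_self hreg,
    dartReversal_mul_dartSource, Matrix.mul_smul, Matrix.mul_one]
  push_cast
  module

lemma hashimoto_pow_mul_dartTarget (hreg : X.IsRegularOfDegree (q + 1)) (k : ℕ) :
    hashimoto X ^ k * dartTarget X =
      dartTarget X * lucasU (q : ℝ) (X.adjMatrix ℝ) (k + 1) -
        dartSource X * lucasU (q : ℝ) (X.adjMatrix ℝ) k := by
  induction k with
  | zero => simp [lucasU]
  | succ k ih =>
    rw [pow_succ', Matrix.mul_assoc, ih, Matrix.mul_sub, ← Matrix.mul_assoc, ← Matrix.mul_assoc,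
      hashimoto_mul_dartTarget, hashimoto_mul_dartSource hreg, lucasU.eq_3]
    simp only [Matrix.sub_mul, Matrix.mul_sub, Matrix.mul_assoc, Matrix.smul_mul, Matrix.mul_smul]
    abel

lemma trace_hashimoto_pow_add_three (hreg : X.IsRegularOfDegree (q + 1)) (k : ℕ) :
    (hashimoto X ^ (k + 3)).trace = (hashimoto X ^ (k + 1)).trace +
      (lucasU (q : ℝ) (X.adjMatrix ℝ) (k + 4) -
        (q : ℝ) • lucasU (q : ℝ) (X.adjMatrix ℝ) (k + 2)).trace -
      (lucasU (q : ℝ) (X.adjMatrix ℝ) (k + 2) -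
        (q : ℝ) • lucasU (q : ℝ) (X.adjMatrix ℝ) k).trace := by
  set U := lucasU (q : ℝ) (X.adjMatrix ℝ) with hU
  have hrec (j : ℕ) : X.adjMatrix ℝ * U (j + 1) = U (j + 2) + (q : ℝ) • U j := by
    rw [hU, lucasU.eq_3, sub_add_cancel]
  have hS : (dartSource X)ᵀ * (hashimoto X ^ (k + 2) * dartTarget X) = U (k + 4) - U (k + 2) := by
    rw [hashimoto_pow_mul_dartTarget hreg, Matrix.mul_sub, ← Matrix.mul_assoc, ← Matrix.mul_assoc,
      transpose_dartSource_mul_dartTarget, transpose_dartSource_mul_self hreg, ← hU, hrec,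
      Matrix.smul_mul, Matrix.one_mul]
    push_cast
    module
  have hE : (dartTarget X)ᵀ * (hashimoto X ^ (k + 1) * dartTarget X) =
      (q : ℝ) • (U (k + 2) - U k) := by
    rw [hashimoto_pow_mul_dartTarget hreg, Matrix.mul_sub, ← Matrix.mul_assoc, ← Matrix.mul_assoc,
      transpose_dartTarget_mul_dartSource, transpose_dartTarget_mul_self hreg, ← hU, hrec,
      Matrix.smul_mul, Matrix.one_mul]
    push_cast
    module
  rw [hashimoto_pow_add_two X (k + 1), Matrix.trace_sub, Matrix.trace_add,
    Matrix.trace_mul_comm _ (dartSource X)ᵀ, Matrix.trace_mul_comm _ (dartTarget X)ᵀ, hS, hE]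
  simp only [Matrix.trace_sub, Matrix.trace_smul, smul_eq_mul]
  ring

lemma trace_hashimoto_pow_odd (hreg : X.IsRegularOfDegree (q + 1)) (m : ℕ) :
    (hashimoto X ^ (2 * m + 1)).trace =
      (lucasU (q : ℝ) (X.adjMatrix ℝ) (2 * m + 2) -
        (q : ℝ) • lucasU (q : ℝ) (X.adjMatrix ℝ) (2 * m)).trace := by
  induction m with
  | zero => simp [trace_hashimoto, lucasU]
  | succ m ih =>
    rw [show 2 * (m + 1) + 1 = 2 * m + 3 by ring, trace_hashimoto_pow_add_three hreg, ih]
    simp only [mul_add, mul_one, add_assoc, Nat.reduceAdd]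
    ring

end Hashimoto

theorem trace_Wk_odd {q n : ℕ} (hq : 1 ≤ q) (hn : 2 ≤ n)
    (X : SimpleGraph (Fin n)) [DecidableRel X.Adj]
    (hconn : X.Connected) (hreg : X.IsRegularOfDegree (q + 1))
    (k : ℕ) (hk : 1 ≤ k) (hko : Odd k) :
    (hashimoto X ^ k).trace =
      Real.sqrt q ^ k *
        (Polynomial.aeval ((Real.sqrt q)⁻¹ • X.adjMatrix ℝ) (Tpoly k)).trace := by
  obtain ⟨m, rfl⟩ := hko
  have hs : Real.sqrt q ≠ 0 := by positivity
  rw [trace_hashimoto_pow_odd hreg, ← smul_eq_mul (Real.sqrt q ^ _), ← Matrix.trace_smul,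
    smul_aeval_Tpoly_succ hs, Real.sq_sqrt q.cast_nonneg]
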